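/- arXiv:2105.14536 — 6 statements merged into one kernel-verified Lean document; each statement's English description precedes it below -/
import Mathlib

section
/- Let φ : ℝ → ℝ be bounded, supported in [−R, R] for some R > 0, and satisfy both the zeroth moment condition and the first moment condition. Then interpolation with φ is second-order accurate on smooth functions: there exists a constant C > 0, depending only on φ, such that for every twice continuously differentiable f : ℝ → ℝ with sup_{y∈ℝ} |f''(y)| ≤ M, every h > 0, and every x ∈ ℝ, one has | Σ_{j∈ℤ} f(j·h)·φ(x/h − j) − f(x) | ≤ C·M·h². -/
lemma taylor_aux (f : ℝ → ℝ) (hf : ContDiff ℝ 2 f) (M : ℝ)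
    (hM : ∀ y : ℝ, |iteratedDeriv 2 f y| ≤ M) (x y : ℝ) :
    |f y - f x - deriv f x * (y - x)| ≤ M * (y - x) ^ 2 := by
  have hM0 : 0 ≤ M := (abs_nonneg _).trans (hM 0)
  have hd : Differentiable ℝ f := hf.differentiable (by norm_num)
  have hd' : Differentiable ℝ (deriv f) := by
    have := hf.differentiable_iteratedDeriv 1 (by norm_num)
    rwa [iteratedDeriv_one] at this
  have hlip : ∀ a b : ℝ, |deriv f b - deriv f a| ≤ M * |b - a| := by
    intro a b
    have := convex_univ.norm_image_sub_le_of_norm_deriv_le (f := deriv f) (C := M)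
      (fun z _ => hd' z) (fun z _ => by
        have := hM z
        rw [iteratedDeriv_succ, iteratedDeriv_one] at this
        exact this) (Set.mem_univ a) (Set.mem_univ b)
    exact this
  have hg : ∀ t, HasDerivAt (fun t => f t - deriv f x * t) (deriv f t - deriv f x) t := by
    intro t
    have := (hd t).hasDerivAt.sub ((hasDerivAt_id t).const_mul (deriv f x))
    rw [mul_one] at this
    exact this
  have := (convex_uIcc x y).norm_image_sub_le_of_norm_deriv_le
    (f := fun t => f t - deriv f x * t) (C := M * |y - x|)
    (fun z _ => (hg z).differentiableAt) (fun z hz => by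
      rw [(hg z).deriv]
      refine (hlip x z).trans ?_
      exact mul_le_mul_of_nonneg_left (Set.abs_sub_left_of_mem_uIcc hz) hM0)
    Set.left_mem_uIcc Set.right_mem_uIcc
  rw [Real.norm_eq_abs, Real.norm_eq_abs, mul_assoc, abs_mul_abs_self] at this
  calc _ = |f y - deriv f x * y - (f x - deriv f x * x)| := by congr 1; ring
    _ ≤ _ := this
    _ = _ := by ring

/-- Interpolation with a bounded, compactly supported kernel satisfying the zeroth and
first moment conditions is second-order accurate on twice continuously differentiable
functions. -/
theorem zeroth_first_moment_second_order_accuracy (φ : ℝ → ℝ) (R B : ℝ) (hR : 0 < R)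
    (hbound : ∀ x : ℝ, |φ x| ≤ B)
    (hsupp : ∀ x : ℝ, x ∉ Set.Icc (-R) R → φ x = 0)
    (h0 : ∀ r : ℝ, ∑' j : ℤ, φ (r - j) = 1)
    (h1 : ∀ r : ℝ, ∑' j : ℤ, (r - j) * φ (r - j) = 0) :
    ∃ C > 0, ∀ f : ℝ → ℝ, ContDiff ℝ 2 f → ∀ M : ℝ,
      (∀ y : ℝ, |iteratedDeriv 2 f y| ≤ M) → ∀ h : ℝ, 0 < h → ∀ x : ℝ,
      |(∑' j : ℤ, f ((j : ℝ) * h) * φ (x / h - j)) - f x| ≤ C * M * h ^ 2 := by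
  have hB : 0 ≤ B := (abs_nonneg _).trans (hbound 0)
  refine ⟨(2 * R + 1) * (R ^ 2 * (B + 1)), by positivity, ?_⟩
  intro f hf M hM h hh x
  have hM0 : 0 ≤ M := (abs_nonneg _).trans (hM 0)
  obtain ⟨r, hr⟩ : ∃ r, r = x / h := ⟨_, rfl⟩
  have hx : x = r * h := by rw [hr]; field_simp
  rw [← hr]
  set S : Finset ℤ := Finset.Icc ⌈r - R⌉ ⌊r + R⌋ with hS
  have hmem : ∀ j : ℤ, j ∈ S ↔ r - R ≤ j ∧ (j : ℝ) ≤ r + R := by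
    intro j
    rw [hS, Finset.mem_Icc, Int.ceil_le, Int.le_floor]
  have hz : ∀ j : ℤ, j ∉ S → φ (r - j) = 0 := by
    intro j hj
    apply hsupp
    intro hc
    exact hj ((hmem j).2 ⟨by linarith [hc.2], by linarith [hc.1]⟩)
  have e0 := h0 r
  have e1 := h1 r
  rw [tsum_eq_sum (s := S) (fun j hj => hz j hj)] at e0
  rw [tsum_eq_sum (s := S) (fun j hj => by rw [hz j hj, mul_zero])] at e1
  rw [tsum_eq_sum (s := S) (fun j hj => by rw [hz j hj, mul_zero])]
  have key : (∑ j ∈ S, f ((j : ℝ) * h) * φ (r - j)) - f x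
      = ∑ j ∈ S, (f ((j : ℝ) * h) - f x - deriv f x * ((j : ℝ) * h - x)) * φ (r - j) := by
    have : ∑ j ∈ S, (f ((j : ℝ) * h) - f x - deriv f x * ((j : ℝ) * h - x)) * φ (r - j)
        = (∑ j ∈ S, f ((j : ℝ) * h) * φ (r - j)) - f x * (∑ j ∈ S, φ (r - j))
          + deriv f x * h * ∑ j ∈ S, (r - j) * φ (r - j) := by
      rw [Finset.mul_sum, Finset.mul_sum, ← Finset.sum_sub_distrib, ← Finset.sum_add_distrib]
      refine Finset.sum_congr rfl fun j _ => ?_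
      have : (j : ℝ) * h - x = -(h * (r - j)) := by rw [hx]; ring
      rw [this]; ring
    rw [this, e0, e1]; ring
  rw [key]
  have hcard : (S.card : ℝ) ≤ 2 * R + 1 := by
    rw [hS, Int.card_Icc]
    rcases le_total 0 (⌊r + R⌋ + 1 - ⌈r - R⌉) with hc | hc
    · have : (((⌊r + R⌋ + 1 - ⌈r - R⌉).toNat : ℤ) : ℝ) = ((⌊r + R⌋ + 1 - ⌈r - R⌉ : ℤ) : ℝ) := by
        rw [Int.toNat_of_nonneg hc]
      rw [Int.cast_natCast] at this
      rw [this]; push_cast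
      linarith [Int.floor_le (r + R), Int.le_ceil (r - R)]
    · rw [Int.toNat_of_nonpos hc]; simp; linarith
  have hterm : ∀ j ∈ S, |(f ((j : ℝ) * h) - f x - deriv f x * ((j : ℝ) * h - x)) * φ (r - j)|
      ≤ R ^ 2 * (B + 1) * M * h ^ 2 := by
    intro j hj
    obtain ⟨ha, hb⟩ := (hmem j).1 hj
    have hsq : (r - j) ^ 2 ≤ R ^ 2 := sq_le_sq' (by linarith) (by linarith)
    have hT := taylor_aux f hf M hM x (j * h)
    have he : ((j : ℝ) * h - x) ^ 2 = (r - j) ^ 2 * h ^ 2 := by rw [hx]; ring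
    rw [he] at hT
    rw [abs_mul]
    calc _ ≤ (M * ((r - j) ^ 2 * h ^ 2)) * (B + 1) := by
          apply mul_le_mul hT ((hbound _).trans (by linarith)) (abs_nonneg _) (by positivity)
      _ ≤ (M * (R ^ 2 * h ^ 2)) * (B + 1) := by gcongr
      _ = _ := by ring
  calc _ ≤ ∑ j ∈ S, |(f ((j : ℝ) * h) - f x - deriv f x * ((j : ℝ) * h - x)) * φ (r - j)| :=
        Finset.abs_sum_le_sum_abs _ _
    _ ≤ ∑ j ∈ S, R ^ 2 * (B + 1) * M * h ^ 2 := Finset.sum_le_sum hterm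
    _ = S.card * (R ^ 2 * (B + 1) * M * h ^ 2) := by rw [Finset.sum_const, nsmul_eq_mul]
    _ ≤ (2 * R + 1) * (R ^ 2 * (B + 1) * M * h ^ 2) := by gcongr
    _ = _ := by ring
end

section
/- For every n ≥ 1 and every odd integer k with 1 ≤ k ≤ n, the n-th order B-spline kernel φ_n satisfies Σ_{j∈ℤ} (r−j)^k · φ_n(r−j) = 0 for all r ∈ ℝ. In particular, every B-spline kernel φ_n with n ≥ 1 satisfies the first moment condition, φ_n with n ≥ 3 satisfies the third moment condition with constant 0, and φ_n with n ≥ 5 satisfies the fifth moment condition with constant 0. -/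
open MeasureTheory

/-- The zeroth-order B-spline kernel: the indicator function of `[-1/2, 1/2]`. -/
noncomputable def bspline0 : ℝ → ℝ :=
  Set.indicator (Set.Icc (-(1 / 2) : ℝ) (1 / 2)) (fun _ => 1)

/-- The B-spline kernels, defined recursively by convolution against `bspline0`. -/
noncomputable def bspline : ℕ → ℝ → ℝ
  | 0 => bspline0
  | n + 1 => fun r => ∫ s : ℝ, bspline n (r - s) * bspline0 s

theorem bs_succ (n : ℕ) (r : ℝ) :
    bspline (n + 1) r = ∫ s in (-(1 / 2) : ℝ)..(1 / 2), bspline n (r - s) := by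
  rw [intervalIntegral.integral_of_le (by norm_num), ← integral_Icc_eq_integral_Ioc,
    ← integral_indicator measurableSet_Icc]
  show (∫ s : ℝ, bspline n (r - s) * bspline0 s) = _
  congr 1
  ext s
  unfold bspline0
  by_cases h : s ∈ Set.Icc (-(1 / 2) : ℝ) (1 / 2) <;> simp only [Set.indicator_of_mem, Set.indicator_of_notMem, h, not_false_eq_true, mul_one, mul_zero]

theorem bs_succ' (n : ℕ) (r : ℝ) :
    bspline (n + 1) r = ∫ s in (r - 1 / 2)..(r + 1 / 2), bspline n s := by
  rw [bs_succ, intervalIntegral.integral_comp_sub_left (fun x => bspline n x) r]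
  congr 1; ring

theorem bs_ii (n : ℕ) : ∀ a b : ℝ, IntervalIntegrable (bspline n) volume a b := by
  induction n with
  | zero =>
    intro a b
    have h : Integrable bspline0 := by
      unfold bspline0
      rw [integrable_indicator_iff measurableSet_Icc]
      exact integrableOn_const (by simp)
    exact h.intervalIntegrable
  | succ n ih =>
    intro a b
    have hc : Continuous (fun x => ∫ s in (0 : ℝ)..x, bspline n s) :=
      intervalIntegral.continuous_primitive ih 0
    have : bspline (n + 1) = fun r => (∫ s in (0 : ℝ)..(r + 1 / 2), bspline n s)
        - ∫ s in (0 : ℝ)..(r - 1 / 2), bspline n s := by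
      ext r
      rw [bs_succ', intervalIntegral.integral_interval_sub_left (ih _ _) (ih _ _)]
    rw [this]
    apply Continuous.intervalIntegrable
    exact (hc.comp (continuous_id.add continuous_const)).sub
      (hc.comp (continuous_id.sub continuous_const))

theorem bs_even (n : ℕ) : ∀ x : ℝ, bspline n (-x) = bspline n x := by
  induction n with
  | zero =>
    intro x
    show bspline0 (-x) = bspline0 x
    unfold bspline0
    have : (-x ∈ Set.Icc (-(1 / 2) : ℝ) (1 / 2)) ↔ (x ∈ Set.Icc (-(1 / 2) : ℝ) (1 / 2)) := by
      simp only [Set.mem_Icc]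
      constructor <;> rintro ⟨h1, h2⟩ <;> constructor <;> linarith
    simp only [Set.indicator_apply, this]
  | succ n ih =>
    intro x
    rw [bs_succ, bs_succ]
    have := intervalIntegral.integral_comp_neg (a := -(1 / 2)) (b := 1 / 2)
      (fun s => bspline n (x - s))
    rw [neg_neg] at this
    rw [← this]
    congr 1
    ext s
    rw [← ih]
    congr 1; ring

theorem bs_supp (n : ℕ) : ∀ x : ℝ, (n + 1 : ℝ) / 2 < |x| → bspline n x = 0 := by
  induction n with
  | zero =>
    intro x hx
    show bspline0 x = 0
    unfold bspline0
    apply Set.indicator_of_notMem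
    rintro ⟨h1, h2⟩
    have := abs_le.2 ⟨h1, h2⟩
    norm_num at hx
    linarith
  | succ n ih =>
    intro x hx
    rw [bs_succ]
    apply intervalIntegral.integral_zero_ae
    refine Filter.Eventually.of_forall fun s hs => ?_
    rw [Set.uIoc_of_le (by norm_num)] at hs
    apply ih
    have h1 : |s| ≤ 1 / 2 := abs_le.2 ⟨hs.1.le, hs.2⟩
    have h2 := abs_sub_abs_le_abs_sub x s
    push_cast at hx
    linarith

/-- The moment sums. -/
noncomputable def bsM (n k : ℕ) (r : ℝ) : ℝ :=
  ∑' j : ℤ, (r - (j : ℝ)) ^ k * bspline n (r - j)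

theorem bs_zero_of (n N : ℕ) (r : ℝ) (h : |r| + n + 1 ≤ N) (j : ℤ)
    (hj : j ∉ Finset.Icc (-(N : ℤ)) N) : bspline n (r - j) = 0 := by
  apply bs_supp
  have h1 : (N : ℝ) < |(j : ℝ)| := by
    have : (N : ℤ) < |j| := by
      by_contra hh
      push Not at hh
      exact hj (Finset.mem_Icc.2 (abs_le.1 hh))
    exact_mod_cast this
  have h2 := abs_sub_abs_le_abs_sub (j : ℝ) r
  rw [abs_sub_comm] at h2
  have : (0 : ℝ) ≤ n := Nat.cast_nonneg n
  linarith

theorem bsM_fin (n k N : ℕ) (r : ℝ) (h : |r| + n + 1 ≤ N) :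
    bsM n k r = ∑ j ∈ Finset.Icc (-(N : ℤ)) N, (r - (j : ℝ)) ^ k * bspline n (r - j) := by
  apply tsum_eq_sum
  intro j hj
  rw [bs_zero_of n N r h j hj, mul_zero]

theorem bsM_per (n k : ℕ) : Function.Periodic (bsM n k) 1 := by
  intro r
  unfold bsM
  rw [← (Equiv.addRight (1 : ℤ)).tsum_eq]
  congr 1
  ext j
  have : r + 1 - ((Equiv.addRight (1 : ℤ) j : ℤ) : ℝ) = r - j := by
    simp
  rw [this]

theorem bsM_odd (n k : ℕ) (hk : Odd k) (r : ℝ) : bsM n k (-r) = - bsM n k r := by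
  unfold bsM
  rw [← (Equiv.neg ℤ).tsum_eq, ← tsum_neg]
  congr 1
  ext j
  have : -r - ((Equiv.neg ℤ j : ℤ) : ℝ) = -(r - j) := by
    simp; ring
  rw [this, bs_even, hk.neg_pow, neg_mul]

theorem bs_ii_shift (n : ℕ) (c a b : ℝ) :
    IntervalIntegrable (fun s => bspline n (c - s)) volume a b := by
  have := (bs_ii n (c - a) (c - b)).comp_sub_left c
  simpa using this

theorem bsM_ii (n k : ℕ) (r : ℝ) (f : ℝ → ℝ) (hf : Continuous f) :
    IntervalIntegrable (fun s => f s * bsM n k (r - s)) volume (-(1 / 2)) (1 / 2) := by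
  obtain ⟨N, hN⟩ := exists_nat_ge (|r| + 1 / 2 + n + 1)
  have h1 : IntervalIntegrable (fun s => ∑ j ∈ Finset.Icc (-(N : ℤ)) N,
      (f s * (r - s - (j : ℝ)) ^ k) * bspline n (r - j - s)) volume (-(1 / 2)) (1 / 2) := by
    have := IntervalIntegrable.sum (μ := volume) (a := -(1 / 2)) (b := 1 / 2)
      (Finset.Icc (-(N : ℤ)) N)
      (f := fun j s => (f s * (r - s - (j : ℝ)) ^ k) * bspline n (r - j - s)) ?_
    · refine this.congr ?_
      intro s _
      simp
    intro j _
    apply IntervalIntegrable.continuousOn_mul (bs_ii_shift n _ _ _)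
    apply Continuous.continuousOn
    fun_prop
  refine h1.congr ?_
  intro s hs
  rw [Set.uIoc_of_le (by norm_num)] at hs
  have h1 : |s| ≤ 1 / 2 := abs_le.2 ⟨hs.1.le, hs.2⟩
  have h2 := abs_sub r s
  dsimp only
  rw [bsM_fin n k N (r - s) (by linarith), Finset.mul_sum]
  refine Finset.sum_congr rfl fun j _ => ?_
  rw [mul_assoc]
  congr 3; ring

theorem bsM_step (n k : ℕ) (r : ℝ) :
    bsM (n + 1) k r = ∑ i ∈ Finset.range (k + 1), ∫ s in (-(1 / 2) : ℝ)..(1 / 2),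
      ((k.choose i : ℝ) * s ^ (k - i)) * bsM n i (r - s) := by
  obtain ⟨N, hN⟩ := exists_nat_ge (|r| + 1 + n + 1)
  rw [bsM_fin (n + 1) k N r (by push_cast; linarith)]
  rw [← intervalIntegral.integral_finsetSum
    (fun i _ => bsM_ii n i r (fun s => (k.choose i : ℝ) * s ^ (k - i)) (by fun_prop))]
  have : ∀ j : ℤ, (r - (j : ℝ)) ^ k * bspline (n + 1) (r - j) =
      ∫ s in (-(1 / 2) : ℝ)..(1 / 2), (r - (j : ℝ)) ^ k * bspline n (r - j - s) := by
    intro j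
    rw [intervalIntegral.integral_const_mul, bs_succ]
  simp_rw [this]
  rw [← intervalIntegral.integral_finsetSum
    (fun j _ => (bs_ii_shift n _ _ _).const_mul _)]
  apply intervalIntegral.integral_congr
  intro s hs
  rw [Set.uIcc_of_le (by norm_num)] at hs
  have h1 : |s| ≤ 1 / 2 := abs_le.2 hs
  have h2 := abs_sub r s
  dsimp only
  have h3 : ∀ i, bsM n i (r - s) = _ := fun i => bsM_fin n i N (r - s) (by linarith)
  simp_rw [h3, Finset.mul_sum]
  rw [Finset.sum_comm]
  refine Finset.sum_congr rfl fun j _ => ?_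
  have h4 : r - (j : ℝ) = (r - s - j) + s := by ring
  have h5 : r - (j : ℝ) - s = r - s - j := by ring
  rw [h5, h4, add_pow, Finset.sum_mul]
  refine Finset.sum_congr rfl fun i _ => ?_
  ring

theorem bsM_const_step (n : ℕ) (h : ∀ k ≤ n, ∃ c : ℝ, ∀ᵐ r : ℝ, bsM n k r = c)
    (k : ℕ) (hk : k ≤ n + 1) (r r' : ℝ) : bsM (n + 1) k r = bsM (n + 1) k r' := by
  rw [bsM_step, bsM_step]
  refine Finset.sum_congr rfl fun i hi => ?_
  rw [Finset.mem_range] at hi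
  rcases Nat.lt_or_ge i k with hik | hik
  · obtain ⟨c, hc⟩ := h i (by omega)
    have key : ∀ r : ℝ, (∫ s in (-(1 / 2) : ℝ)..(1 / 2),
        ((k.choose i : ℝ) * s ^ (k - i)) * bsM n i (r - s)) =
        ∫ s in (-(1 / 2) : ℝ)..(1 / 2), ((k.choose i : ℝ) * s ^ (k - i)) * c := by
      intro r
      apply intervalIntegral.integral_congr_ae
      have := (Measure.measurePreserving_sub_left volume r).quasiMeasurePreserving.ae hc
      filter_upwards [this] with s hs _
      rw [hs]
    rw [key, key]
  · obtain rfl : i = k := by omega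
    have key : ∀ r : ℝ, (∫ s in (-(1 / 2) : ℝ)..(1 / 2),
        ((i.choose i : ℝ) * s ^ (i - i)) * bsM n i (r - s)) =
        ∫ s in (0 : ℝ)..(0 + 1), bsM n i s := by
      intro r
      rw [(bsM_per n i).intervalIntegral_add_eq 0 (r - 1 / 2)]
      simp only [Nat.choose_self, Nat.cast_one, Nat.sub_self, pow_zero, one_mul]
      rw [intervalIntegral.integral_comp_sub_left (fun x => bsM n i x) r]
      congr 1; ring
    rw [key, key]

theorem bsM_base : ∀ᵐ r : ℝ, bsM 0 0 r = 1 := by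
  have hc : (Set.range fun j : ℤ => (j : ℝ) - 1 / 2).Countable := Set.countable_range _
  filter_upwards [hc.ae_notMem volume] with r hr
  unfold bsM
  rw [tsum_eq_single ⌊r + 1 / 2⌋]
  · show _ * bspline0 _ = _
    unfold bspline0
    rw [Set.indicator_of_mem]
    · simp
    · have h1 := Int.floor_le (r + 1 / 2)
      have h2 := Int.lt_floor_add_one (r + 1 / 2)
      constructor <;> linarith
  · intro j hj
    show _ * bspline0 _ = _
    unfold bspline0
    rw [Set.indicator_of_notMem, mul_zero]
    rintro ⟨h1, h2⟩
    apply hj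
    symm
    rw [Int.floor_eq_iff]
    refine ⟨by linarith, lt_of_le_of_ne (by linarith) fun h => hr ⟨j + 1, ?_⟩⟩
    push_cast
    linarith

theorem bsM_ae (n : ℕ) : ∀ k ≤ n, ∃ c : ℝ, ∀ᵐ r : ℝ, bsM n k r = c := by
  induction n with
  | zero =>
    intro k hk
    obtain rfl : k = 0 := by omega
    exact ⟨1, bsM_base⟩
  | succ n ih =>
    intro k hk
    exact ⟨bsM (n + 1) k 0, Filter.Eventually.of_forall fun r => bsM_const_step n ih k hk r 0⟩

theorem bsM_main (n k : ℕ) (hn : 1 ≤ n) (hk : Odd k) (hkn : k ≤ n) (r : ℝ) :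
    bsM n k r = 0 := by
  obtain ⟨m, rfl⟩ : ∃ m, n = m + 1 := ⟨n - 1, by omega⟩
  have h1 := bsM_const_step m (bsM_ae m) k hkn (-r) r
  rw [bsM_odd _ _ hk] at h1
  linarith

/-- For `n ≥ 1` and odd `k` with `1 ≤ k ≤ n`, the `n`-th order B-spline kernel satisfies
the `k`-th moment condition with constant `0`; in particular every B-spline kernel with
`n ≥ 1` satisfies the first moment condition, with `n ≥ 3` the third moment condition
with constant `0`, and with `n ≥ 5` the fifth moment condition with constant `0`. -/
theorem bspline_odd_moments_vanish :
    (∀ n k : ℕ, 1 ≤ n → Odd k → 1 ≤ k → k ≤ n →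
      ∀ r : ℝ, ∑' j : ℤ, (r - (j : ℝ)) ^ k * bspline n (r - j) = 0) ∧
    (∀ n : ℕ, 1 ≤ n → ∀ r : ℝ, ∑' j : ℤ, (r - (j : ℝ)) * bspline n (r - j) = 0) ∧
    (∀ n : ℕ, 3 ≤ n → ∀ r : ℝ, ∑' j : ℤ, (r - (j : ℝ)) ^ 3 * bspline n (r - j) = 0) ∧
    (∀ n : ℕ, 5 ≤ n → ∀ r : ℝ, ∑' j : ℤ, (r - (j : ℝ)) ^ 5 * bspline n (r - j) = 0) := by
  refine ⟨fun n k hn hk _ hkn r => bsM_main n k hn hk hkn r, fun n hn r => ?_,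
    fun n hn r => bsM_main n 3 (by omega) (by decide) hn r,
    fun n hn r => bsM_main n 5 (by omega) (by decide) hn r⟩
  have := bsM_main n 1 hn (by decide) hn r
  simpa [bsM] using this
end

section
/- For every n ≥ 2, the n-th order B-spline kernel φ_n satisfies the second moment condition with constant K = (n+1)/12: Σ_{j∈ℤ} (r−j)² · φ_n(r−j) = (n+1)/12 for all r ∈ ℝ. In particular, the three-point B-spline (n = 2) has K = 1/4, the four-point B-spline (n = 3) has K = 1/3, the five-point B-spline (n = 4) has K = 5/12, and the six-point B-spline (n = 5) has K = 1/2. -/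
open MeasureTheory

lemma bspline_one (r : ℝ) : bspline 1 r = max (1 - |r|) 0 := by
  have h : ∀ s, bspline0 (r - s) * bspline0 s =
      (Set.Icc (max (-(1/2)) (r - 1/2)) (min (1/2) (r + 1/2)) : Set ℝ).indicator 1 s := by
    intro s
    have e1 : (s ∈ (Set.Icc (max (-(1/2)) (r - 1/2)) (min (1/2) (r + 1/2)) : Set ℝ)) ↔
        (r - s ∈ Set.Icc (-(1 / 2) : ℝ) (1 / 2) ∧ s ∈ Set.Icc (-(1 / 2) : ℝ) (1 / 2)) := by
      simp only [Set.mem_Icc, max_le_iff, le_min_iff]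
      constructor
      · rintro ⟨⟨h1, h2⟩, h3, h4⟩
        refine ⟨⟨?_, ?_⟩, ?_, ?_⟩ <;> linarith
      · rintro ⟨⟨h1, h2⟩, h3, h4⟩
        refine ⟨⟨?_, ?_⟩, ?_, ?_⟩ <;> linarith
    classical
    unfold bspline0
    simp only [Set.indicator_apply, e1]
    by_cases a : r - s ∈ Set.Icc (-(1 / 2) : ℝ) (1 / 2) <;>
      by_cases b : s ∈ Set.Icc (-(1 / 2) : ℝ) (1 / 2) <;> simp only [a, b] <;> simp
  show ∫ s : ℝ, bspline0 (r - s) * bspline0 s = _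
  simp_rw [h]
  rw [integral_indicator_one measurableSet_Icc, Real.volume_real_Icc]
  congr 1
  rcases le_total 0 r with h | h
  · rw [abs_of_nonneg h, min_eq_left (by linarith), max_eq_right (by linarith)]; ring
  · rw [abs_of_nonpos h, min_eq_right (by linarith), max_eq_left (by linarith)]; ring

lemma bspline_succ (n : ℕ) (r : ℝ) :
    bspline (n + 1) r = ∫ s in (-(1/2) : ℝ)..(1/2), bspline n (r - s) := by
  show ∫ s : ℝ, bspline n (r - s) * bspline0 s = _
  rw [intervalIntegral.integral_of_le (by norm_num), ← integral_Icc_eq_integral_Ioc,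
    ← integral_indicator measurableSet_Icc]
  congr 1
  ext s
  unfold bspline0
  classical
  simp only [Set.indicator_apply]
  split_ifs <;> simp

lemma bspline_cont (n : ℕ) : Continuous (bspline (n + 1)) := by
  induction n with
  | zero =>
    have : bspline 1 = fun r => max (1 - |r|) 0 := funext bspline_one
    rw [this]; fun_prop
  | succ n ih =>
    have : bspline (n + 2) = fun r => ∫ s in (-(1/2) : ℝ)..(1/2), bspline (n + 1) (r - s) :=
      funext (bspline_succ (n + 1))
    rw [this]
    apply intervalIntegral.continuous_parametric_intervalIntegral_of_continuous'
    fun_prop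

lemma bspline_supp (n : ℕ) : ∀ x : ℝ, (n : ℝ) + 1 ≤ |x| → bspline (n + 1) x = 0 := by
  induction n with
  | zero =>
    intro x hx
    rw [bspline_one]
    push_cast at hx
    apply max_eq_right; linarith
  | succ n ih =>
    intro x hx
    rw [bspline_succ]
    apply intervalIntegral.integral_zero_ae
    refine Filter.Eventually.of_forall fun s hs => ih _ ?_
    rw [Set.uIoc_of_le (by norm_num)] at hs
    have h1 : |s| ≤ 1 / 2 := abs_le.2 ⟨hs.1.le, hs.2⟩
    have h2 := abs_sub_abs_le_abs_sub x s
    push_cast at hx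
    linarith

lemma far {C u r : ℝ} (hu : |r - u| ≤ 1) {j : ℤ}
    (hj : j ∉ Finset.Icc ⌊r - C - 1⌋ ⌈r + C + 1⌉) : C ≤ |u - j| := by
  by_contra! hc
  apply hj
  rw [abs_lt] at hc
  rw [abs_le] at hu
  rw [Finset.mem_Icc]
  constructor
  · have h1 := Int.floor_le (r - C - 1)
    have : ((⌊r - C - 1⌋ : ℤ) : ℝ) ≤ j := by linarith
    exact_mod_cast this
  · have h1 := Int.le_ceil (r + C + 1)
    have : (j : ℝ) ≤ ⌈r + C + 1⌉ := by linarith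
    exact_mod_cast this

lemma swap (f g p : ℝ → ℝ) (C : ℝ) (hf : Continuous f) (hC : ∀ x, C ≤ |x| → f x = 0)
    (hg : ∀ x, g x = ∫ s in (-(1/2) : ℝ)..(1/2), f (x - s)) (r : ℝ) :
    ∑' j : ℤ, p (r - j) * g (r - j) =
      ∫ s in (-(1/2) : ℝ)..(1/2), ∑' j : ℤ, p (r - j) * f ((r - s) - j) := by
  have key : ∀ s ∈ Set.uIcc (-(1/2) : ℝ) (1/2),
      ∀ j ∉ Finset.Icc ⌊r - C - 1⌋ ⌈r + C + 1⌉, f (r - s - j) = 0 := by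
    intro s hs j hj
    rw [Set.uIcc_of_le (by norm_num)] at hs
    apply hC
    refine far ?_ hj
    rw [sub_sub_cancel, abs_le]
    constructor <;> linarith [hs.1, hs.2]
  have e : ∫ s in (-(1/2) : ℝ)..(1/2), ∑' j : ℤ, p (r - j) * f ((r - s) - j) =
      ∫ s in (-(1/2) : ℝ)..(1/2), ∑ j ∈ Finset.Icc ⌊r - C - 1⌋ ⌈r + C + 1⌉,
        p (r - j) * f ((r - s) - j) := by
    apply intervalIntegral.integral_congr
    intro s hs
    apply tsum_eq_sum
    intro j hj
    rw [key s hs j hj, mul_zero]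
  rw [e, intervalIntegral.integral_finsetSum]
  · rw [tsum_eq_sum (s := Finset.Icc ⌊r - C - 1⌋ ⌈r + C + 1⌉)]
    · apply Finset.sum_congr rfl
      intro j _
      rw [intervalIntegral.integral_const_mul, hg]
      congr 1
      apply intervalIntegral.integral_congr
      intro s _
      show f _ = f _
      congr 1; ring
    · intro j hj
      rw [hg]
      have : ∫ s in (-(1/2) : ℝ)..(1/2), f (r - j - s) = ∫ s in (-(1/2) : ℝ)..(1/2), (0 : ℝ) := by
        apply intervalIntegral.integral_congr
        intro s hs
        have := key s hs j hj
        show f _ = 0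
        rw [← this]; congr 1; ring
      rw [this]; simp
  · intro j _
    apply Continuous.intervalIntegrable
    fun_prop

lemma summ (f p : ℝ → ℝ) (C : ℝ) (hC : ∀ x, C ≤ |x| → f x = 0) (u : ℝ) :
    Summable fun j : ℤ => p (u - j) * f (u - j) := by
  apply summable_of_ne_finset_zero (s := Finset.Icc ⌊u - C - 1⌋ ⌈u + C + 1⌉)
  intro j hj
  rw [hC _ (far (by simp) hj), mul_zero]

lemma base (a : ℝ → ℝ) (u : ℝ) : ∑' j : ℤ, a (u - j) * bspline 1 (u - j) =
    a (Int.fract u) * (1 - Int.fract u) + a (Int.fract u - 1) * Int.fract u := by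
  have h0 := Int.fract_nonneg u
  have h1 := Int.fract_lt_one u
  have hu := Int.floor_add_fract u
  set t := Int.fract u
  rw [tsum_eq_sum (s := {⌊u⌋, ⌊u⌋ + 1})]
  · rw [Finset.sum_pair (by omega)]
    have e1 : u - (⌊u⌋ : ℝ) = t := by linarith
    have e2 : u - ((⌊u⌋ + 1 : ℤ) : ℝ) = t - 1 := by push_cast; linarith
    rw [e1, e2, bspline_one, bspline_one, abs_of_nonneg h0, abs_of_nonpos (by linarith),
      max_eq_left (by linarith), max_eq_left (by linarith)]
    ring
  · intro j hj
    simp only [Finset.mem_insert, Finset.mem_singleton, not_or] at hj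
    rw [bspline_one, max_eq_right, mul_zero]
    rcases lt_or_gt_of_ne hj.1 with h | h
    · have : (j : ℝ) + 1 ≤ ⌊u⌋ := by exact_mod_cast h
      have := le_abs_self (u - j)
      linarith
    · have : (⌊u⌋ : ℝ) + 2 ≤ j := by
        have : ⌊u⌋ + 2 ≤ j := by omega
        exact_mod_cast this
      have := neg_le_abs (u - j)
      linarith

lemma step0 (n : ℕ) (h0 : ∀ u : ℝ, ∑' j : ℤ, bspline (n + 1) (u - j) = 1) (r : ℝ) :
    ∑' j : ℤ, bspline (n + 2) (r - j) = 1 := by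
  have := swap (bspline (n+1)) (bspline (n+2)) (fun _ => 1) _ (bspline_cont n) (bspline_supp n)
    (bspline_succ (n+1)) r
  simp only [one_mul, h0] at this
  rw [this]; norm_num

lemma step1 (n : ℕ) (h0 : ∀ u : ℝ, ∑' j : ℤ, bspline (n + 1) (u - j) = 1)
    (h1 : ∀ u : ℝ, ∑' j : ℤ, (u - j) * bspline (n + 1) (u - j) = 0) (r : ℝ) :
    ∑' j : ℤ, (r - j) * bspline (n + 2) (r - j) = 0 := by
  have := swap (bspline (n+1)) (bspline (n+2)) (fun x => x) _ (bspline_cont n) (bspline_supp n)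
    (bspline_succ (n+1)) r
  rw [this]
  have e : ∀ s : ℝ, ∑' j : ℤ, (r - j) * bspline (n + 1) (r - s - j) = s := by
    intro s
    have s0 := summ _ (fun _ => s) _ (bspline_supp n) (r - s)
    have s1 := summ _ (fun x => x) _ (bspline_supp n) (r - s)
    have := s1.tsum_add s0
    rw [tsum_mul_left, h0, h1] at this
    rw [zero_add, mul_one] at this
    refine Eq.trans ?_ this
    apply tsum_congr
    intro j; ring
  simp only [e]
  rw [integral_id]; norm_num

lemma step2 (n : ℕ) (h0 : ∀ u : ℝ, ∑' j : ℤ, bspline (n + 1) (u - j) = 1)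
    (h1 : ∀ u : ℝ, ∑' j : ℤ, (u - j) * bspline (n + 1) (u - j) = 0) (r : ℝ) :
    ∑' j : ℤ, (r - j) ^ 2 * bspline (n + 2) (r - j) =
      ∫ s in (-(1/2) : ℝ)..(1/2),
        ((∑' j : ℤ, (r - s - j) ^ 2 * bspline (n + 1) (r - s - j)) + s ^ 2) := by
  have := swap (bspline (n+1)) (bspline (n+2)) (fun x => x ^ 2) _ (bspline_cont n)
    (bspline_supp n) (bspline_succ (n+1)) r
  rw [this]
  congr 1
  ext s
  have s0 := summ _ (fun _ => s ^ 2) _ (bspline_supp n) (r - s)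
  have s1 := (summ _ (fun x => x) _ (bspline_supp n) (r - s)).mul_left (2 * s)
  have s2 := summ _ (fun x => x ^ 2) _ (bspline_supp n) (r - s)
  have h := (s2.add s1).tsum_add s0
  rw [s2.tsum_add s1, tsum_mul_left, tsum_mul_left, h0, h1, mul_zero, add_zero, mul_one] at h
  rw [← h]
  apply tsum_congr
  intro j; ring

lemma mom01 (n : ℕ) : (∀ u : ℝ, ∑' j : ℤ, bspline (n + 1) (u - j) = 1) ∧
    (∀ u : ℝ, ∑' j : ℤ, (u - j) * bspline (n + 1) (u - j) = 0) := by
  induction n with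
  | zero =>
    constructor
    · intro u
      have := base (fun _ => 1) u
      simp only [one_mul] at this
      rw [zero_add, this]; ring
    · intro u
      rw [zero_add, base (fun x => x) u]; ring
  | succ n ih => exact ⟨step0 n ih.1, step1 n ih.1 ih.2⟩

lemma mom2 (n : ℕ) (r : ℝ) :
    ∑' j : ℤ, (r - (j : ℝ)) ^ 2 * bspline (n + 2) (r - j) = ((n : ℝ) + 3) / 12 := by
  induction n generalizing r with
  | zero =>
    rw [step2 0 (mom01 0).1 (mom01 0).2]
    have b : ∀ u : ℝ, ∑' j : ℤ, (u - (j : ℝ)) ^ 2 * bspline 1 (u - j) =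
        Int.fract u * (1 - Int.fract u) := by
      intro u
      rw [base (fun x => x ^ 2) u]; ring
    have hc : Continuous fun u : ℝ => Int.fract u * (1 - Int.fract u) := by
      have : (fun u : ℝ => Int.fract u * (1 - Int.fract u)) =
          (fun x : ℝ => x * (1 - x)) ∘ Int.fract := rfl
      rw [this]
      apply ContinuousOn.comp_fract''
      · fun_prop
      · norm_num
    simp only [zero_add, b]
    rw [intervalIntegral.integral_add]
    · rw [intervalIntegral.integral_comp_sub_left
        (fun u : ℝ => Int.fract u * (1 - Int.fract u)) r]
      have hp : Function.Periodic (fun u : ℝ => Int.fract u * (1 - Int.fract u)) 1 := by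
        intro x; simp
      have e := hp.intervalIntegral_add_eq (r - 1/2) 0
      rw [show r - 1/2 + 1 = r - -(1/2) by ring, zero_add] at e
      rw [e]
      have e2 : ∫ x in (0:ℝ)..1, Int.fract x * (1 - Int.fract x) =
          ∫ x in (0:ℝ)..1, (x - x ^ 2) := by
        apply intervalIntegral.integral_congr
        intro x hx
        rw [Set.uIcc_of_le (by norm_num)] at hx
        show Int.fract x * (1 - Int.fract x) = x - x ^ 2
        rcases hx.2.lt_or_eq with h | h
        · rw [Int.fract_eq_self.2 ⟨hx.1, h⟩]; ring
        · subst h; simp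
      rw [e2, intervalIntegral.integral_sub (by simp) (by simp)]
      simp only [integral_pow, integral_id]
      norm_num
    · apply Continuous.intervalIntegrable
      exact hc.comp (by fun_prop : Continuous fun s : ℝ => r - s)
    · simp
  | succ n ih =>
    rw [step2 (n+1) (mom01 (n+1)).1 (mom01 (n+1)).2]
    simp only [ih]
    rw [intervalIntegral.integral_add (by simp) (by simp)]
    simp only [integral_pow, intervalIntegral.integral_const]
    push_cast
    norm_num
    ring

/-- For `n ≥ 2` the `n`-th order B-spline kernel satisfies the second moment condition
with constant `K = (n+1)/12`; in particular the three-, four-, five-, and six-point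
B-splines have second-moment constants `1/4`, `1/3`, `5/12`, and `1/2` respectively. -/
theorem bspline_second_moment :
    (∀ n : ℕ, 2 ≤ n →
      ∀ r : ℝ, ∑' j : ℤ, (r - (j : ℝ)) ^ 2 * bspline n (r - j) = ((n : ℝ) + 1) / 12) ∧
    (∀ r : ℝ, ∑' j : ℤ, (r - (j : ℝ)) ^ 2 * bspline 2 (r - j) = 1 / 4) ∧
    (∀ r : ℝ, ∑' j : ℤ, (r - (j : ℝ)) ^ 2 * bspline 3 (r - j) = 1 / 3) ∧
    (∀ r : ℝ, ∑' j : ℤ, (r - (j : ℝ)) ^ 2 * bspline 4 (r - j) = 5 / 12) ∧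
    (∀ r : ℝ, ∑' j : ℤ, (r - (j : ℝ)) ^ 2 * bspline 5 (r - j) = 1 / 2) := by

  have key : ∀ n : ℕ, 2 ≤ n →
      ∀ r : ℝ, ∑' j : ℤ, (r - (j : ℝ)) ^ 2 * bspline n (r - j) = ((n : ℝ) + 1) / 12 := by
    intro n hn r
    obtain ⟨m, rfl⟩ := Nat.exists_eq_add_of_le' hn
    rw [mom2]; push_cast; ring
  refine ⟨key, fun r => ?_, fun r => ?_, fun r => ?_, fun r => ?_⟩
  · rw [key 2 (by norm_num)]; norm_num
  · rw [key 3 (by norm_num)]; norm_num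
  · rw [key 4 (by norm_num)]; norm_num
  · rw [key 5 (by norm_num)]; norm_num
end

section
/- The four-point IB kernel φ satisfies the even–odd condition: Σ_{j∈ℤ, j even} φ(r−j) = 1/2 and Σ_{j∈ℤ, j odd} φ(r−j) = 1/2 for all r ∈ ℝ (and hence also the zeroth moment condition Σ_{j∈ℤ} φ(r−j) = 1 for all r ∈ ℝ). -/
/-- The four-point IB kernel of Peskin. -/
noncomputable def ibKernel4 (r : ℝ) : ℝ :=
  if |r| ≤ 1 then (1 / 8) * (3 - 2 * |r| + Real.sqrt (1 + 4 * |r| - 4 * r ^ 2))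
  else if |r| ≤ 2 then (1 / 8) * (5 - 2 * |r| - Real.sqrt (-7 + 12 * |r| - 4 * r ^ 2))
  else 0

lemma ibKernel4_neg (r : ℝ) : ibKernel4 (-r) = ibKernel4 r := by
  simp [ibKernel4]

lemma ibKernel4_zero {r : ℝ} (h : 2 ≤ |r|) : ibKernel4 r = 0 := by
  unfold ibKernel4
  rw [if_neg (by linarith)]
  split_ifs with h2
  · have h3 : |r| = 2 := le_antisymm h2 h
    have h4 : r ^ 2 = 4 := by rw [← sq_abs, h3]; norm_num
    rw [h3, h4]
    norm_num
  · rfl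

lemma ibKernel4_inner {r : ℝ} (h0 : 0 ≤ r) (h1 : r ≤ 1) :
    ibKernel4 r = (1 / 8) * (3 - 2 * r + Real.sqrt (1 + 4 * r - 4 * r ^ 2)) := by
  unfold ibKernel4
  rw [abs_of_nonneg h0, if_pos h1]

lemma ibKernel4_outer {r : ℝ} (h0 : 1 ≤ r) (h1 : r ≤ 2) :
    ibKernel4 r = (1 / 8) * (5 - 2 * r - Real.sqrt (-7 + 12 * r - 4 * r ^ 2)) := by
  rcases h0.eq_or_lt with rfl | h
  · norm_num [ibKernel4]
  · unfold ibKernel4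
    rw [abs_of_nonneg (by linarith), if_neg (by linarith), if_pos h1]

lemma ibKernel4_pair_aux {s : ℝ} (h0 : 0 ≤ s) (h1 : s ≤ 1) :
    ibKernel4 s + ibKernel4 (2 - s) = 1 / 2 := by
  rw [ibKernel4_inner h0 h1, ibKernel4_outer (by linarith) (by linarith)]
  have : -7 + 12 * (2 - s) - 4 * (2 - s) ^ 2 = 1 + 4 * s - 4 * s ^ 2 := by ring
  rw [this]
  ring

lemma ibKernel4_pair {s : ℝ} (h0 : 0 ≤ s) (h1 : s ≤ 2) :
    ibKernel4 s + ibKernel4 (s - 2) = 1 / 2 := by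
  rw [← ibKernel4_neg (s - 2), neg_sub]
  rcases le_total s 1 with h | h
  · exact ibKernel4_pair_aux h0 h
  · have := ibKernel4_pair_aux (s := 2 - s) (by linarith) (by linarith)
    rw [sub_sub_cancel] at this
    linarith

lemma ibKernel4_hasSum (r : ℝ) :
    HasSum (fun k : ℤ => ibKernel4 (r - 2 * (k : ℝ))) (1 / 2) := by
  have hm := Int.floor_le (r / 2)
  have hm' := Int.lt_floor_add_one (r / 2)
  generalize ⌊r / 2⌋ = m at hm hm'
  have key : ∑ k ∈ ({m, m + 1} : Finset ℤ), ibKernel4 (r - 2 * (k : ℝ)) = 1 / 2 := by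
    rw [Finset.sum_pair (by omega)]
    have := ibKernel4_pair (s := r - 2 * (m : ℝ)) (by linarith) (by linarith)
    rw [← this]
    push_cast
    ring_nf
  rw [← key]
  apply hasSum_sum_of_ne_finset_zero
  intro k hk
  simp only [Finset.mem_insert, Finset.mem_singleton, not_or] at hk
  apply ibKernel4_zero
  rcases lt_or_ge k m with h | h
  · have h2 : (k : ℝ) + 1 ≤ m := by exact_mod_cast h
    exact le_trans (by linarith) (le_abs_self _)
  · have h2 : m + 2 ≤ k := by omega
    have h2 : (m : ℝ) + 2 ≤ k := by exact_mod_cast h2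
    exact le_trans (by linarith) (neg_le_abs _)

lemma ibKernel4_even (r : ℝ) :
    HasSum (fun j : {j : ℤ | Even j} => ibKernel4 (r - ((j : ℤ) : ℝ))) (1 / 2) := by
  have inj : Function.Injective (fun k : ℤ => 2 * k) := fun a b h => by
    simpa using h
  have hr : {j : ℤ | Even j} = Set.range (fun k : ℤ => 2 * k) := by
    ext j
    simp [even_iff_exists_two_mul, eq_comm]
  rw [hr]
  refine (inj.hasSum_range_iff (f := fun j : ℤ => ibKernel4 (r - (j : ℝ)))).2 ?_
  simpa [Function.comp_def] using ibKernel4_hasSum r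

lemma ibKernel4_odd (r : ℝ) :
    HasSum (fun j : {j : ℤ | Odd j} => ibKernel4 (r - ((j : ℤ) : ℝ))) (1 / 2) := by
  have inj : Function.Injective (fun k : ℤ => 2 * k + 1) := fun a b h => by
    simpa using h
  have hr : {j : ℤ | Odd j} = Set.range (fun k : ℤ => 2 * k + 1) := by
    ext j
    simp [Odd, eq_comm]
  rw [hr]
  refine (inj.hasSum_range_iff (f := fun j : ℤ => ibKernel4 (r - (j : ℝ)))).2 ?_
  convert ibKernel4_hasSum (r - 1) using 2 with k
  simp only [Function.comp]
  push_cast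
  ring_nf

/-- The four-point IB kernel satisfies the even–odd condition (and hence also the zeroth
moment condition). -/
theorem ibKernel4_even_odd :
    (∀ r : ℝ, ∑' j : {j : ℤ // Even j}, ibKernel4 (r - ((j : ℤ) : ℝ)) = 1 / 2) ∧
    (∀ r : ℝ, ∑' j : {j : ℤ // Odd j}, ibKernel4 (r - ((j : ℤ) : ℝ)) = 1 / 2) ∧
    (∀ r : ℝ, ∑' j : ℤ, ibKernel4 (r - j) = 1) := by
  refine ⟨fun r => (ibKernel4_even r).tsum_eq, fun r => (ibKernel4_odd r).tsum_eq, fun r => ?_⟩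
  have hc : IsCompl {j : ℤ | Even j} {j : ℤ | Odd j} := Int.isCompl_even_odd
  have := HasSum.add_isCompl (f := fun j : ℤ => ibKernel4 (r - (j : ℝ))) hc
    (ibKernel4_even r) (ibKernel4_odd r)
  rw [this.tsum_eq]
  norm_num
end

section
/- The four-point IB kernel φ satisfies the sum-of-squares condition with constant C = 3/8: Σ_{j∈ℤ} φ(r−j)² = 3/8 for all r ∈ ℝ. -/
lemma ib_inner (r x a : ℝ) (ha : |r| = a) (h : a ≤ 1) (hx : 4 * a - 4 * a ^ 2 = 4 * x - 4 * x ^ 2) :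
    ibKernel4 r = (1 / 8) * (3 - 2 * a + Real.sqrt (1 + 4 * x - 4 * x ^ 2)) := by
  have h2 : r ^ 2 = a ^ 2 := by rw [← ha, sq_abs]
  unfold ibKernel4
  rw [h2, ha, if_pos h]
  congr 3
  linarith

lemma ib_outer (r x a : ℝ) (ha : |r| = a) (h1 : 1 ≤ a) (h : a ≤ 2)
    (hx : -8 + 12 * a - 4 * a ^ 2 = 4 * x - 4 * x ^ 2) :
    ibKernel4 r = (1 / 8) * (5 - 2 * a - Real.sqrt (1 + 4 * x - 4 * x ^ 2)) := by
  have h2 : r ^ 2 = a ^ 2 := by rw [← ha, sq_abs]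
  have e : 1 + 4 * x - 4 * x ^ 2 = -7 + 12 * a - 4 * a ^ 2 := by linarith
  unfold ibKernel4
  rw [h2, ha, e]
  by_cases h3 : a ≤ 1
  · have : a = 1 := le_antisymm h3 h1
    subst this
    norm_num
  · rw [if_neg h3, if_pos h]

lemma ib_zero (r : ℝ) (h : 2 ≤ |r|) : ibKernel4 r = 0 := by
  rcases h.eq_or_lt with h | h
  · rw [ib_outer r 0 2 h.symm (by norm_num) le_rfl (by norm_num)]
    norm_num
  · unfold ibKernel4
    rw [if_neg (by linarith), if_neg (by linarith)]

/-- The four-point IB kernel satisfies the sum-of-squares condition with constant `3/8`. -/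
theorem ibKernel4_sum_of_squares :
    ∀ r : ℝ, ∑' j : ℤ, ibKernel4 (r - j) ^ 2 = 3 / 8 := by
  intro r
  obtain ⟨n, x, hx0, hx1, rfl⟩ : ∃ (n : ℤ) (x : ℝ), 0 ≤ x ∧ x < 1 ∧ r = x + n :=
    ⟨⌊r⌋, Int.fract r, Int.fract_nonneg r, Int.fract_lt_one r, (Int.fract_add_floor r).symm⟩
  have hz : ∀ j ∉ ({n - 1, n, n + 1, n + 2} : Finset ℤ), ibKernel4 (x + n - j) ^ 2 = 0 := by
    intro j hj
    simp only [Finset.mem_insert, Finset.mem_singleton, not_or] at hj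
    have hj' : j ≤ n - 2 ∨ n + 3 ≤ j := by omega
    rw [ib_zero, zero_pow two_ne_zero]
    rcases hj' with h | h
    · have h' : (j : ℝ) ≤ n - 2 := by exact_mod_cast h
      exact le_trans (by linarith) (le_abs_self _)
    · have h' : (n : ℝ) + 3 ≤ j := by exact_mod_cast h
      exact le_trans (by linarith) (neg_le_abs _)
  rw [tsum_eq_sum hz, Finset.sum_insert (by simp; omega), Finset.sum_insert (by simp),
    Finset.sum_insert (by simp), Finset.sum_singleton]
  push_cast
  rw [ib_outer (x + n - (n - 1)) x (x + 1) (by rw [abs_of_nonneg] <;> linarith)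
      (by linarith) (by linarith) (by ring),
    ib_inner (x + n - n) x x (by rw [abs_of_nonneg] <;> linarith) (by linarith) (by ring),
    ib_inner (x + n - (n + 1)) x (1 - x) (by rw [abs_of_nonpos] <;> linarith)
      (by linarith) (by ring),
    ib_outer (x + n - (n + 2)) x (2 - x) (by rw [abs_of_nonpos] <;> linarith)
      (by linarith) (by linarith) (by ring)]
  have hs : Real.sqrt (1 + 4 * x - 4 * x ^ 2) ^ 2 = 1 + 4 * x - 4 * x ^ 2 :=
    Real.sq_sqrt (by nlinarith)
  linear_combination (1 / 16) * hs
end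

section
/- The three-point IB kernel φ satisfies the zeroth moment condition (Σ_{j∈ℤ} φ(r−j) = 1 for all r ∈ ℝ), the first moment condition (Σ_{j∈ℤ} (r−j)·φ(r−j) = 0 for all r ∈ ℝ), and the sum-of-squares condition with constant C = 1/2 (Σ_{j∈ℤ} φ(r−j)² = 1/2 for all r ∈ ℝ). -/
/-- The three-point IB kernel of Roma et al. -/
noncomputable def ibKernel3 (r : ℝ) : ℝ :=
  if |r| ≤ 1 / 2 then (1 / 3) * (1 + Real.sqrt (1 - 3 * r ^ 2))
  else if |r| ≤ 3 / 2 then (1 / 6) * (5 - 3 * |r| - Real.sqrt (1 - 3 * (1 - |r|) ^ 2))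
  else 0

/-- Value of the kernel at the three relevant grid points, and vanishing elsewhere. -/
lemma ibKernel3_values (s : ℝ) (h1 : -(1 / 2) ≤ s) (h2 : s < 1 / 2) :
    ibKernel3 s = (1 / 3) * (1 + Real.sqrt (1 - 3 * s ^ 2)) ∧
    ibKernel3 (s - 1) = (1 / 6) * (2 + 3 * s - Real.sqrt (1 - 3 * s ^ 2)) ∧
    ibKernel3 (s + 1) = (1 / 6) * (2 - 3 * s - Real.sqrt (1 - 3 * s ^ 2)) := by
  refine ⟨?_, ?_, ?_⟩
  · unfold ibKernel3
    rw [if_pos (abs_le.2 ⟨h1, h2.le⟩)]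
  · unfold ibKernel3
    have ha : |s - 1| = 1 - s := by rw [abs_of_nonpos (by linarith)]; ring
    rw [ha, if_neg (by linarith), if_pos (by linarith)]
    rw [show (1 - (1 - s)) = s by ring]
    ring
  · unfold ibKernel3
    have ha : |s + 1| = s + 1 := abs_of_nonneg (by linarith)
    rw [ha]
    by_cases hs : s + 1 ≤ 1 / 2
    · have h : s = -(1 / 2) := by linarith
      subst h
      have hq : Real.sqrt (1 / 4) = 1 / 2 := by
        rw [show (1 / 4 : ℝ) = (1 / 2) ^ 2 by norm_num]
        exact Real.sqrt_sq (by norm_num)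
      rw [if_pos hs]
      rw [show (1 - 3 * (-(1 / 2) + 1) ^ 2 : ℝ) = 1 / 4 by norm_num,
        show (1 - 3 * (-(1 / 2)) ^ 2 : ℝ) = 1 / 4 by norm_num, hq]
      norm_num
    · rw [if_neg hs, if_pos (by linarith)]
      rw [show (1 - (s + 1)) = -s by ring, neg_sq]
      ring

/-- The kernel vanishes when `|r| ≥ 3/2`. -/
lemma ibKernel3_eq_zero (r : ℝ) (h : 3 / 2 ≤ |r|) : ibKernel3 r = 0 := by
  unfold ibKernel3
  rw [if_neg (by linarith)]
  split_ifs with h'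
  · have ha : |r| = 3 / 2 := le_antisymm h' h
    have hq : Real.sqrt (1 / 4) = 1 / 2 := by
      rw [show (1 / 4 : ℝ) = (1 / 2) ^ 2 by norm_num]
      exact Real.sqrt_sq (by norm_num)
    rw [ha, show (1 - 3 * (1 - 3 / 2) ^ 2 : ℝ) = 1 / 4 by norm_num, hq]
    norm_num
  · rfl

/-- Reduction of the lattice sums to three terms. -/
lemma ibKernel3_tsum (F : ℝ → ℝ) (hF : ∀ x, ibKernel3 x = 0 → F x = 0) (r : ℝ) :
    ∃ s : ℝ, -(1 / 2) ≤ s ∧ s < 1 / 2 ∧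
      ∑' j : ℤ, F (r - j) = F (s + 1) + F s + F (s - 1) := by
  set n : ℤ := ⌊r + 1 / 2⌋ with hn
  have hl : (n : ℝ) ≤ r + 1 / 2 := Int.floor_le _
  have hu : r + 1 / 2 < n + 1 := Int.lt_floor_add_one _
  refine ⟨r - n, by linarith, by linarith, ?_⟩
  rw [tsum_eq_sum (s := ({n - 1, n, n + 1} : Finset ℤ))]
  · rw [Finset.sum_insert (by simp; omega), Finset.sum_insert (by simp), Finset.sum_singleton]
    push_cast
    rw [show r - ((n : ℝ) - 1) = r - n + 1 by ring, show r - ((n : ℝ) + 1) = r - n - 1 by ring]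
    ring
  · intro j hj
    simp only [Finset.mem_insert, Finset.mem_singleton, not_or] at hj
    apply hF
    apply ibKernel3_eq_zero
    have : j ≤ n - 2 ∨ n + 2 ≤ j := by omega
    rcases this with h | h
    · have h' : (j : ℝ) ≤ n - 2 := by exact_mod_cast h
      exact le_trans (by linarith) (le_abs_self _)
    · have h' : (n : ℝ) + 2 ≤ j := by exact_mod_cast h
      exact le_trans (by linarith) (neg_le_abs _)

/-- The three-point IB kernel satisfies the zeroth moment condition, the first moment
condition, and the sum-of-squares condition with constant `C = 1/2`. -/
theorem ibKernel3_moment_and_sum_of_squares :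
    (∀ r : ℝ, ∑' j : ℤ, ibKernel3 (r - j) = 1) ∧
    (∀ r : ℝ, ∑' j : ℤ, (r - (j : ℝ)) * ibKernel3 (r - j) = 0) ∧
    (∀ r : ℝ, ∑' j : ℤ, ibKernel3 (r - j) ^ 2 = 1 / 2) := by
  refine ⟨fun r => ?_, fun r => ?_, fun r => ?_⟩
  · obtain ⟨s, h1, h2, h⟩ := ibKernel3_tsum ibKernel3 (fun _ h => h) r
    obtain ⟨e0, e1, e2⟩ := ibKernel3_values s h1 h2
    rw [h, e0, e1, e2]
    ring
  · obtain ⟨s, h1, h2, h⟩ := ibKernel3_tsum (fun x => x * ibKernel3 x)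
      (fun x h => by simp [h]) r
    obtain ⟨e0, e1, e2⟩ := ibKernel3_values s h1 h2
    refine h.trans ?_
    rw [e0, e1, e2]
    ring
  · obtain ⟨s, h1, h2, h⟩ := ibKernel3_tsum (fun x => ibKernel3 x ^ 2)
      (fun x h => by simp [h]) r
    obtain ⟨e0, e1, e2⟩ := ibKernel3_values s h1 h2
    refine h.trans ?_
    have hq : Real.sqrt (1 - 3 * s ^ 2) ^ 2 = 1 - 3 * s ^ 2 := Real.sq_sqrt (by nlinarith)
    rw [e0, e1, e2]
    linear_combination (1 / 6) * hq
end
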